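/- arXiv:2409.18557 — 2 statements merged into one kernel-verified Lean document; each statement's English description precedes it below -/
import Mathlib

section
/- Under the critically loaded scaling, for each i ∈ {1,…,C} one has (1 − ρ_i^{(k)}) · √(s_i^{(k)}) → θ_i as k → ∞, where ρ_i^{(k)} := λ^{(k)} α_i d_i / s_i^{(k)} and θ_i := θ · √(ϱ_i/(n_i ϱ)). -/
open Finset Filter Topology MeasureTheory

/-- Erlang's loss formula (Erlang-B): blocking probability of an M/GI/s/s queue
with offered load `a`. -/
noncomputable def erlangB (s : ℕ) (a : ℝ) : ℝ :=
  (a ^ s / Nat.factorial s) / ∑ ℓ ∈ Finset.range (s + 1), a ^ ℓ / Nat.factorial ℓ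

/-- Standard normal density φ. -/
noncomputable def stdGaussianPDF (x : ℝ) : ℝ :=
  Real.exp (-x ^ 2 / 2) / Real.sqrt (2 * Real.pi)

/-- Standard normal cumulative distribution function Φ. -/
noncomputable def stdGaussianCDF (x : ℝ) : ℝ :=
  ∫ t in Set.Iic x, stdGaussianPDF t

/-- Relative demand of class `i`: ϱ_i = α_i d_i n_i. -/
noncomputable def relDemand {C : ℕ} (n : Fin C → ℕ) (α d : Fin C → ℝ) (i : Fin C) : ℝ :=
  α i * d i * n i

/-- Total relative demand: ϱ = ∑ i, ϱ_i. -/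
noncomputable def totDemand {C : ℕ} (n : Fin C → ℕ) (α d : Fin C → ℝ) : ℝ :=
  ∑ i, relDemand n α d i

/-- ψ_k = sup { x ∈ [0,1] : k - ∑_i ⌊x · k ϱ_i/(n_i f_k ϱ)⌋ n_i f_k ≥ max_i n_i f_k },
with the convention `sSup ∅ = 0` of real numbers. -/
noncomputable def psi {C : ℕ} (n : Fin C → ℕ) (α d : Fin C → ℝ) (f : ℕ → ℕ) (k : ℕ) : ℝ :=
  sSup {x : ℝ | x ∈ Set.Icc (0 : ℝ) 1 ∧
    (k : ℝ) - ∑ i, (⌊x * ((k : ℝ) * relDemand n α d i /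
        ((n i : ℝ) * (f k : ℝ) * totDemand n α d))⌋ : ℝ) * ((n i : ℝ) * (f k : ℝ))
      ≥ ((Finset.univ.sup (fun i => n i * f k) : ℕ) : ℝ)}

/-- Number of class-`i` "virtual servers": s_i^(k) = ⌊ψ_k · k ϱ_i/(n_i f_k ϱ)⌋. -/
noncomputable def srv {C : ℕ} (n : Fin C → ℕ) (α d : Fin C → ℝ) (f : ℕ → ℕ)
    (i : Fin C) (k : ℕ) : ℕ :=
  ⌊psi n α d f k * ((k : ℝ) * relDemand n α d i /
      ((n i : ℝ) * (f k : ℝ) * totDemand n α d))⌋₊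

/-- θ_i = θ √(ϱ_i/(n_i ϱ)). -/
noncomputable def thetaI {C : ℕ} (n : Fin C → ℕ) (α d : Fin C → ℝ) (θ : ℝ) (i : Fin C) : ℝ :=
  θ * Real.sqrt (relDemand n α d i / ((n i : ℝ) * totDemand n α d))

/-- The critical scaling `(1 - ρ) √m → θ` is inherited by any server count that stays within
bounded distance of the proportion `c` of `m`. -/
theorem tendsto_critical_scaling_of_bounded_diff {ι : Type*} {l : Filter ι} {m s ρ : ι → ℝ}
    {c K θ : ℝ} (hc : 0 < c) (hm : Tendsto m l atTop) (hs : ∀ᶠ k in l, |s k - c * m k| ≤ K)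
    (hcrit : Tendsto (fun k => (1 - ρ k) * Real.sqrt (m k)) l (𝓝 θ)) :
    Tendsto (fun k => (1 - ρ k * (c * m k) / s k) * Real.sqrt (s k)) l
      (𝓝 (θ * Real.sqrt c)) := by
  have hcm : Tendsto (fun k => c * m k) l atTop := hm.const_mul_atTop hc
  have hsTop : Tendsto s l atTop := by
    refine tendsto_atTop_mono' l ?_ (tendsto_atTop_add_const_right l (-K) hcm)
    filter_upwards [hs] with k hk
    linarith [(abs_le.mp hk).1]
  have hsqrt : Tendsto (fun k => Real.sqrt (s k)) l atTop :=
    Real.tendsto_sqrt_atTop.comp hsTop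
  have hdiff : Tendsto (fun k => (s k - c * m k) / Real.sqrt (s k)) l (𝓝 0) := by
    refine squeeze_zero_norm' ?_ (hsqrt.const_div_atTop K)
    filter_upwards [hs] with k hk
    rw [Real.norm_eq_abs, abs_div, abs_of_nonneg (Real.sqrt_nonneg _)]
    gcongr
  have hratio : Tendsto (fun k => s k / m k) l (𝓝 c) := by
    have h0 : Tendsto (fun k => (s k - c * m k) / m k) l (𝓝 0) := by
      refine squeeze_zero_norm' ?_ (hm.const_div_atTop K)
      filter_upwards [hs, hm.eventually_gt_atTop 0] with k hk hmk
      rw [Real.norm_eq_abs, abs_div, abs_of_pos hmk]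
      gcongr
    have h1 := h0.add_const c
    rw [zero_add] at h1
    refine h1.congr' ?_
    filter_upwards [hm.eventually_gt_atTop 0] with k hmk
    field_simp
    ring
  have hlim := hdiff.add ((hcrit.const_mul c).div (hratio.sqrt) (Real.sqrt_pos.mpr hc).ne')
  have hval : 0 + c * θ / Real.sqrt c = θ * Real.sqrt c := by
    rw [zero_add, mul_comm c θ, mul_div_assoc, Real.div_sqrt]
  rw [hval] at hlim
  refine hlim.congr' ?_
  filter_upwards [hm.eventually_gt_atTop 0, hsTop.eventually_gt_atTop 0] with k hmk hsk
  have hsm : 0 < Real.sqrt (m k) := Real.sqrt_pos.mpr hmk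
  have hss : 0 < Real.sqrt (s k) := Real.sqrt_pos.mpr hsk
  have hm2 : Real.sqrt (m k) ^ 2 = m k := Real.sq_sqrt hmk.le
  have hs2 : Real.sqrt (s k) ^ 2 = s k := Real.sq_sqrt hsk.le
  rw [Pi.div_apply, Real.sqrt_div hsk.le]
  generalize Real.sqrt (m k) = a at *
  generalize Real.sqrt (s k) = b at *
  rw [← hm2, ← hs2]
  field_simp
  ring

theorem relDemand_pos {C : ℕ} {n : Fin C → ℕ} {α d : Fin C → ℝ} (hn : ∀ i, 0 < n i)
    (hα : ∀ i, 0 < α i) (hd : ∀ i, 0 < d i) (i : Fin C) : 0 < relDemand n α d i :=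
  mul_pos (mul_pos (hα i) (hd i)) (Nat.cast_pos.mpr (hn i))

theorem totDemand_pos {C : ℕ} {n : Fin C → ℕ} {α d : Fin C → ℝ} (hn : ∀ i, 0 < n i)
    (hα : ∀ i, 0 < α i) (hd : ∀ i, 0 < d i) (i : Fin C) : 0 < totDemand n α d :=
  Finset.sum_pos (fun j _ => relDemand_pos hn hα hd j) ⟨i, Finset.mem_univ i⟩

theorem psi_le_one {C : ℕ} (n : Fin C → ℕ) (α d : Fin C → ℝ) (f : ℕ → ℕ) (k : ℕ) :
    psi n α d f k ≤ 1 :=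
  Real.sSup_le (fun _ hx => hx.1.2) zero_le_one

theorem psi_nonneg {C : ℕ} (n : Fin C → ℕ) (α d : Fin C → ℝ) (f : ℕ → ℕ) (k : ℕ) :
    0 ≤ psi n α d f k :=
  Real.sSup_nonneg fun _ hx => hx.1.1

theorem one_sub_sup_mul_div_le_psi {C : ℕ} {n : Fin C → ℕ} {α d : Fin C → ℝ} {f : ℕ → ℕ} {k : ℕ}
    (hn : ∀ i, 0 < n i) (htot : 0 < totDemand n α d) (hf : 0 < f k) (hk : 0 < k)
    (hle : ((Finset.univ.sup n : ℕ) : ℝ) * f k / k ≤ 1) :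
    1 - ((Finset.univ.sup n : ℕ) : ℝ) * f k / k ≤ psi n α d f k := by
  have hk' : (0 : ℝ) < k := Nat.cast_pos.mpr hk
  have hf' : (0 : ℝ) < f k := Nat.cast_pos.mpr hf
  refine le_csSup ⟨1, fun _ hx => hx.1.2⟩ ⟨⟨sub_nonneg.mpr hle, ?_⟩, ?_⟩
  · exact sub_le_self _ (by positivity)
  set x : ℝ := 1 - ((Finset.univ.sup n : ℕ) : ℝ) * f k / k with hx
  have hsum : ∑ i, (⌊x * ((k : ℝ) * relDemand n α d i /
      ((n i : ℝ) * (f k : ℝ) * totDemand n α d))⌋ : ℝ) * ((n i : ℝ) * (f k : ℝ)) ≤ x * k := by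
    calc _ ≤ ∑ i, x * k / totDemand n α d * relDemand n α d i := by
          refine Finset.sum_le_sum fun i _ => ?_
          have hni : (0 : ℝ) < n i := Nat.cast_pos.mpr (hn i)
          refine (mul_le_mul_of_nonneg_right (Int.floor_le _) (by positivity)).trans_eq ?_
          field_simp
      _ = x * k := by
          rw [← Finset.mul_sum]
          exact div_mul_cancel₀ _ htot.ne'
  have hsup : Finset.univ.sup (fun i => n i * f k) ≤ Finset.univ.sup n * f k :=
    Finset.sup_le fun i hi => Nat.mul_le_mul_right _ (Finset.le_sup hi)
  have hsup' : ((Finset.univ.sup (fun i => n i * f k) : ℕ) : ℝ) ≤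
      ((Finset.univ.sup n : ℕ) : ℝ) * f k := by exact_mod_cast hsup
  have hxk : x * k = k - ((Finset.univ.sup n : ℕ) : ℝ) * f k := by
    rw [hx]
    field_simp
  linarith

/-- The server counts differ from their fluid values by a constant independent of `k`. -/
theorem abs_srv_sub_le {C : ℕ} {n : Fin C → ℕ} {α d : Fin C → ℝ} {f : ℕ → ℕ} {k : ℕ}
    (hn : ∀ i, 0 < n i) (hα : ∀ i, 0 < α i) (hd : ∀ i, 0 < d i) (hf : 0 < f k) (hk : 0 < k)
    (hle : ((Finset.univ.sup n : ℕ) : ℝ) * f k / k ≤ 1) (i : Fin C) :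
    |(srv n α d f i k : ℝ) - relDemand n α d i / (n i * totDemand n α d) * (k / f k)| ≤
      relDemand n α d i / (n i * totDemand n α d) * (Finset.univ.sup n : ℕ) + 1 := by
  have htot := totDemand_pos hn hα hd i
  have hrel := relDemand_pos hn hα hd i
  have hk' : (0 : ℝ) < k := Nat.cast_pos.mpr hk
  have hf' : (0 : ℝ) < f k := Nat.cast_pos.mpr hf
  have hni : (0 : ℝ) < n i := Nat.cast_pos.mpr (hn i)
  have hlow := one_sub_sup_mul_div_le_psi hn htot hf hk hle
  have hup := psi_le_one n α d f k
  have h0 := psi_nonneg n α d f k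
  have harg : (k : ℝ) * relDemand n α d i / ((n i : ℝ) * (f k : ℝ) * totDemand n α d) =
      relDemand n α d i / (n i * totDemand n α d) * (k / f k) := by
    field_simp
  rw [srv, harg]
  set c : ℝ := relDemand n α d i / (n i * totDemand n α d) with hcdef
  have hc : 0 < c := by positivity
  have hcm : 0 < c * (k / f k) := by positivity
  have hfloor := Nat.floor_le (mul_nonneg h0 hcm.le)
  have hlt := Nat.lt_floor_add_one (psi n α d f k * (c * (k / f k)))
  have h1 := mul_le_mul_of_nonneg_right hup hcm.le
  have h2 := mul_le_mul_of_nonneg_right hlow hcm.le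
  have h3 : (1 - ((Finset.univ.sup n : ℕ) : ℝ) * f k / k) * (c * (k / f k)) =
      c * (k / f k) - c * (Finset.univ.sup n : ℕ) := by
    field_simp
  have h4 : 0 ≤ c * (Finset.univ.sup n : ℕ) := by positivity
  rw [abs_le]
  constructor <;> linarith

/-- In the critically loaded regime, (1 - ρ_i^(k)) √(s_i^(k)) → θ_i for each class i. -/
theorem classLoad_halfin_whitt_scaling
    (C : ℕ) (hC : 0 < C) (n : Fin C → ℕ) (hn : ∀ i, 0 < n i)
    (α d : Fin C → ℝ) (hα : ∀ i, 0 < α i) (hd : ∀ i, 0 < d i)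
    (hsum : ∑ i, α i = 1)
    (f : ℕ → ℕ) (hf : ∀ k, 0 < f k)
    (hfk : Tendsto (fun k : ℕ => (f k : ℝ) / k) atTop (𝓝 0))
    (θ : ℝ) (hθ : 0 < θ) (lam : ℕ → ℝ) (hlam : ∀ k, 0 < lam k)
    (hcrit : Tendsto
      (fun k : ℕ => (1 - lam k * totDemand n α d * f k / k) * Real.sqrt ((k : ℝ) / f k))
      atTop (𝓝 θ))
    (i : Fin C) :
    Tendsto
      (fun k : ℕ =>
        (1 - lam k * α i * d i / (srv n α d f i k : ℝ)) * Real.sqrt (srv n α d f i k))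
      atTop (𝓝 (thetaI n α d θ i)) := by
  have htot := totDemand_pos hn hα hd i
  have hrel := relDemand_pos hn hα hd i
  have hni : (0 : ℝ) < n i := Nat.cast_pos.mpr (hn i)
  have hm : Tendsto (fun k : ℕ => (k : ℝ) / f k) atTop atTop := by
    have hpos : ∀ᶠ k : ℕ in atTop, (0 : ℝ) < (f k : ℝ) / k := by
      filter_upwards [eventually_gt_atTop 0] with k hk
      exact div_pos (Nat.cast_pos.mpr (hf k)) (Nat.cast_pos.mpr hk)
    refine (tendsto_inv_nhdsGT_zero.comp
      (tendsto_nhdsWithin_iff.mpr ⟨hfk, hpos⟩)).congr fun k => ?_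
    exact inv_div _ _
  have hle : ∀ᶠ k : ℕ in atTop, ((Finset.univ.sup n : ℕ) : ℝ) * f k / k ≤ 1 := by
    have h := hfk.const_mul ((Finset.univ.sup n : ℕ) : ℝ)
    rw [mul_zero] at h
    filter_upwards [h.eventually_le_const zero_lt_one] with k hk
    rwa [mul_div_assoc]
  have hs : ∀ᶠ k : ℕ in atTop,
      |(srv n α d f i k : ℝ) - relDemand n α d i / (n i * totDemand n α d) * (k / f k)| ≤
        relDemand n α d i / (n i * totDemand n α d) * (Finset.univ.sup n : ℕ) + 1 := by
    filter_upwards [hle, eventually_gt_atTop 0] with k hk hk0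
    exact abs_srv_sub_le hn hα hd (hf k) hk0 hk i
  refine (tendsto_critical_scaling_of_bounded_diff (by positivity) hm hs hcrit).congr' ?_
  filter_upwards [eventually_gt_atTop 0] with k hk
  have hk' : (0 : ℝ) < k := Nat.cast_pos.mpr hk
  have hf' : (0 : ℝ) < f k := Nat.cast_pos.mpr (hf k)
  have hload : lam k * totDemand n α d * f k / k *
      (relDemand n α d i / (n i * totDemand n α d) * (k / f k)) = lam k * α i * d i := by
    rw [relDemand]
    field_simp
  rw [hload]
end

section
/- Under the critically loaded scaling, for each i ∈ {1,…,C} one has √(s_i^{(k)}) · E_{s_i^{(k)}}(λ^{(k)} α_i d_i) → φ(θ_i)/Φ(θ_i) as k → ∞, where θ_i := θ · √(ϱ_i/(n_i ϱ)). -/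
open Finset Filter Topology MeasureTheory

/-- The reciprocal of Erlang's loss formula as an integral. -/
theorem integral_exp_neg_mul_one_add_div_pow (s : ℕ) {a : ℝ} (ha : 0 < a) :
    ∫ t in Set.Ioi (0 : ℝ), Real.exp (-t) * (1 + t / a) ^ s = (erlangB s a)⁻¹ := by
  have hint : ∀ j : ℕ, IntegrableOn (fun t : ℝ => Real.exp (-t) * t ^ j) (Set.Ioi 0) := by
    intro j
    have := Real.GammaIntegral_convergent (s := (j : ℝ) + 1) (by positivity)
    simpa [add_sub_cancel_right, Real.rpow_natCast] using this
  have hval : ∀ j : ℕ, ∫ t in Set.Ioi (0 : ℝ), Real.exp (-t) * t ^ j = (j.factorial : ℝ) := by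
    intro j
    rw [← Real.Gamma_nat_eq_factorial, Real.Gamma_eq_integral (by positivity)]
    simp [add_sub_cancel_right, Real.rpow_natCast]
  have hexpand : ∀ t : ℝ, Real.exp (-t) * (1 + t / a) ^ s =
      ∑ j ∈ Finset.range (s + 1), (s.choose j / a ^ j : ℝ) * (Real.exp (-t) * t ^ j) := by
    intro t
    rw [add_comm, add_pow, Finset.mul_sum]
    refine Finset.sum_congr rfl fun j _ => ?_
    rw [div_pow, one_pow]
    ring
  simp_rw [hexpand]
  rw [integral_finsetSum _ fun j _ => (hint j).const_mul _]
  simp_rw [integral_const_mul, hval]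
  rw [erlangB, inv_div, Finset.sum_div, ← Finset.sum_range_reflect]
  refine Finset.sum_congr rfl fun j hj => ?_
  have hjs : j ≤ s := Nat.lt_succ_iff.mp (Finset.mem_range.mp hj)
  have h1 : s + 1 - 1 - j = s - j := by omega
  have hpow : a ^ s = a ^ (s - j) * a ^ j := by rw [← pow_add, Nat.sub_add_cancel hjs]
  rw [h1, Nat.choose_symm hjs, Nat.cast_choose ℝ hjs, hpow]
  have := Nat.factorial_ne_zero s
  have := Nat.factorial_ne_zero j
  have := Nat.factorial_ne_zero (s - j)
  field_simp

/-- The scaled reciprocal of Erlang's loss formula as an integral. -/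
theorem inv_mul_erlangB_eq_integral (s : ℕ) {a r : ℝ} (ha : 0 < a) (hr : 0 < r) :
    (r * erlangB s a)⁻¹ =
      ∫ u in Set.Ioi (0 : ℝ), Real.exp (-(r * u)) * (1 + r * u / a) ^ s := by
  have h := integral_comp_mul_left_Ioi (fun t : ℝ => Real.exp (-t) * (1 + t / a) ^ s) 0 hr
  rw [h, mul_zero, integral_exp_neg_mul_one_add_div_pow s ha, smul_eq_mul, mul_inv]

theorem integral_exp_linear_sub_sq_eq (β : ℝ) :
    ∫ u in Set.Ioi (0 : ℝ), Real.exp (β * u - u ^ 2 / 2) =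
      stdGaussianCDF β / stdGaussianPDF β := by
  have hφ : 0 < stdGaussianPDF β := by unfold stdGaussianPDF; positivity
  have hshift : stdGaussianCDF β = ∫ u in Set.Ioi (0 : ℝ), stdGaussianPDF (β - u) := by
    have h := integral_sub_left_eq_self
      (fun t : ℝ => (Set.Iic β).indicator stdGaussianPDF t) volume β
    rw [integral_indicator measurableSet_Iic] at h
    rw [stdGaussianCDF, ← h, ← integral_Ici_eq_integral_Ioi,
      ← integral_indicator measurableSet_Ici]
    congr 1
    ext u
    simp [Set.indicator_apply]
  rw [eq_div_iff hφ.ne', hshift, ← integral_mul_const]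
  congr 1
  ext u
  rw [stdGaussianPDF, stdGaussianPDF, mul_div_assoc', ← Real.exp_add]
  congr 2
  ring

theorem stdGaussianCDF_pos (β : ℝ) : 0 < stdGaussianCDF β := by
  have hint : Integrable stdGaussianPDF := by
    have := (integrable_exp_neg_mul_sq (b := 1 / 2) (by norm_num)).div_const
      (Real.sqrt (2 * Real.pi))
    refine this.congr (Eventually.of_forall fun x => ?_)
    simp only [stdGaussianPDF]
    congr 2
    ring
  rw [stdGaussianCDF, setIntegral_pos_iff_support_of_nonneg_ae]
  · have : Function.support stdGaussianPDF = Set.univ := by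
      ext x
      simp only [Function.mem_support, Set.mem_univ, iff_true]
      unfold stdGaussianPDF
      positivity
    simp [this]
  · exact Eventually.of_forall fun x => by simp only [stdGaussianPDF, Pi.zero_apply]; positivity
  · exact hint.integrableOn

theorem tendsto_div_sub_add {r b : ℕ → ℝ} {β : ℝ} (hr : Tendsto r atTop atTop)
    (hb : Tendsto b atTop (𝓝 β)) (c : ℝ) :
    Tendsto (fun k => r k / (r k - b k + c)) atTop (𝓝 1) := by
  have hlim : Tendsto (fun k => (1 - (b k - c) / r k)⁻¹) atTop (𝓝 1) := by
    simpa using (((hb.sub_const c).div_atTop hr).const_sub 1).inv₀ (by simp)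
  refine hlim.congr' ?_
  filter_upwards [hr.eventually_gt_atTop 0] with k hk
  rw [one_sub_div hk.ne', inv_div]
  congr 1
  ring

/-- Second-order expansion of the logarithm in the central limit scaling. -/
theorem tendsto_sq_mul_log_one_add_div_sub {r b : ℕ → ℝ} {β : ℝ} (hr : Tendsto r atTop atTop)
    (hb : Tendsto b atTop (𝓝 β)) {u : ℝ} (hu : 0 ≤ u) :
    Tendsto (fun k => r k ^ 2 * Real.log (1 + u / (r k - b k)) - r k * u) atTop
      (𝓝 (β * u - u ^ 2 / 2)) := by
  have hratio : Tendsto (fun k => r k / (r k - b k)) atTop (𝓝 1) := by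
    simpa using tendsto_div_sub_add hr hb 0
  have hden : Tendsto (fun k => r k - b k) atTop atTop := by
    simpa [sub_eq_add_neg] using hr.atTop_add hb.neg
  have hy : Tendsto (fun k => u / (r k - b k)) atTop (𝓝 0) := hden.const_div_atTop u
  have hlin : Tendsto (fun k => r k ^ 2 * (u / (r k - b k)) - r k * u) atTop (𝓝 (β * u)) := by
    have h := (hratio.mul hb).mul_const u
    rw [one_mul] at h
    refine h.congr' ?_
    filter_upwards [hden.eventually_gt_atTop 0] with k hk
    field_simp
    ring
  have hsq : Tendsto (fun k => r k ^ 2 * (u / (r k - b k)) ^ 2) atTop (𝓝 (u ^ 2)) := by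
    have h := (hratio.pow 2).mul_const (u ^ 2)
    rw [one_pow, one_mul] at h
    exact h.congr fun k => by rw [div_pow, div_pow]; ring
  have hbound : Tendsto (fun k => r k ^ 2 * (u / (r k - b k)) ^ 2 *
      (u / (r k - b k) / (1 - u / (r k - b k)))) atTop (𝓝 0) := by
    simpa using hsq.mul (hy.div (hy.const_sub 1) (by simp))
  have hrem : Tendsto (fun k => r k ^ 2 * (Real.log (1 + u / (r k - b k)) -
      u / (r k - b k) + (u / (r k - b k)) ^ 2 / 2)) atTop (𝓝 0) := by
    refine squeeze_zero_norm' ?_ hbound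
    filter_upwards [hden.eventually_gt_atTop 0, hy.eventually_lt_const one_pos] with k hk hk1
    set y := u / (r k - b k)
    have hy0 : 0 ≤ y := div_nonneg hu hk.le
    have h := Real.abs_log_sub_add_sum_range_le (x := -y) (by rwa [abs_neg, abs_of_nonneg hy0]) 2
    rw [abs_neg, abs_of_nonneg hy0] at h
    have heq : Real.log (1 + y) - y + y ^ 2 / 2 =
        (∑ i ∈ Finset.range 2, (-y) ^ (i + 1) / (i + 1)) + Real.log (1 - -y) := by
      simp [Finset.sum_range_succ]
      ring_nf
    rw [norm_mul, Real.norm_eq_abs, Real.norm_eq_abs, abs_of_nonneg (sq_nonneg (r k)), heq]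
    calc _ ≤ r k ^ 2 * (y ^ (2 + 1) / (1 - y)) := by gcongr
      _ = _ := by ring
  have h := (hlin.sub (hsq.div_const 2)).add hrem
  rw [add_zero] at h
  exact h.congr fun k => by ring

/-- Concavity bound for the exponent of the integrand. -/
theorem sq_mul_log_one_add_div_sub_le {r D u u₀ : ℝ} (hD : 0 < D) (hu : 0 ≤ u) (hu₀ : 0 ≤ u₀) :
    r ^ 2 * Real.log (1 + u / D) - r * u ≤
      (r ^ 2 * Real.log (1 + u₀ / D) - r * u₀) + (r ^ 2 / (D + u₀) - r) * (u - u₀) := by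
  have h1 : 0 < 1 + u / D := by positivity
  have h0 : 0 < 1 + u₀ / D := by positivity
  have h := Real.log_le_sub_one_of_pos (div_pos h1 h0)
  rw [Real.log_div h1.ne' h0.ne'] at h
  have heq : (1 + u / D) / (1 + u₀ / D) - 1 = (u - u₀) / (D + u₀) := by
    field_simp
    ring
  rw [heq] at h
  have h2 := mul_le_mul_of_nonneg_left h (sq_nonneg r)
  have h3 : r ^ 2 / (D + u₀) * (u - u₀) = r ^ 2 * ((u - u₀) / (D + u₀)) := by ring
  linarith

/-- Erlang's loss formula in the Halfin–Whitt scaling. -/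
theorem tendsto_sqrt_mul_erlangB {s : ℕ → ℕ} {a : ℕ → ℝ} {β : ℝ} (hs : Tendsto s atTop atTop)
    (hβ : Tendsto (fun k => ((s k : ℝ) - a k) / Real.sqrt (s k)) atTop (𝓝 β)) :
    Tendsto (fun k => Real.sqrt (s k) * erlangB (s k) (a k)) atTop
      (𝓝 (stdGaussianPDF β / stdGaussianCDF β)) := by
  set r : ℕ → ℝ := fun k => Real.sqrt (s k) with hr_def
  set b : ℕ → ℝ := fun k => ((s k : ℝ) - a k) / r k with hb_def
  have hr : Tendsto r atTop atTop :=
    Real.tendsto_sqrt_atTop.comp (tendsto_natCast_atTop_atTop.comp hs)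
  have hrsq : ∀ k, r k ^ 2 = s k := fun k => Real.sq_sqrt (Nat.cast_nonneg _)
  have hden : Tendsto (fun k => r k - b k) atTop atTop := by
    simpa [sub_eq_add_neg] using hr.atTop_add hβ.neg
  have hgood : ∀ᶠ k in atTop, 0 < r k ∧ 0 < r k - b k ∧ a k = r k * (r k - b k) := by
    filter_upwards [hr.eventually_gt_atTop 0, hden.eventually_gt_atTop 0] with k h1 h2
    refine ⟨h1, h2, ?_⟩
    have : r k * b k = s k - a k := mul_div_cancel₀ _ h1.ne'
    linear_combination -hrsq k + this
  have hrepr : ∀ᶠ k in atTop, ∫ u in Set.Ioi (0 : ℝ),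
      Real.exp (r k ^ 2 * Real.log (1 + u / (r k - b k)) - r k * u) =
        (r k * erlangB (s k) (a k))⁻¹ := by
    filter_upwards [hgood] with k ⟨h1, h2, h3⟩
    rw [inv_mul_erlangB_eq_integral (s k) (by rw [h3]; positivity) h1]
    refine setIntegral_congr_fun measurableSet_Ioi fun u hu => ?_
    have hu' : 0 < u := hu
    have hpos : 0 < 1 + u / (r k - b k) := by positivity
    have hdiv : r k * u / a k = u / (r k - b k) := by
      rw [h3, mul_div_mul_left _ _ h1.ne']
    simp only [hdiv, hrsq]
    rw [sub_eq_neg_add, Real.exp_add, mul_comm (s k : ℝ), Real.exp_mul, Real.exp_log hpos,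
      Real.rpow_natCast]
  set u₀ : ℝ := |β| + 2 with hu₀_def
  have hu₀ : 0 ≤ u₀ := by positivity
  have hslope : Tendsto (fun k => r k ^ 2 / (r k - b k + u₀) - r k) atTop (𝓝 (β - u₀)) := by
    have h := (tendsto_div_sub_add hr hβ u₀).mul (hβ.sub_const u₀)
    rw [one_mul] at h
    refine h.congr' ?_
    filter_upwards [hgood] with k ⟨h1, h2, h3⟩
    have : r k - b k + u₀ ≠ 0 := by positivity
    field_simp
    ring
  have hconst := (tendsto_sq_mul_log_one_add_div_sub hr hβ hu₀).sub (hslope.mul_const u₀)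
  have hmain : Tendsto (fun k => ∫ u in Set.Ioi (0 : ℝ),
      Real.exp (r k ^ 2 * Real.log (1 + u / (r k - b k)) - r k * u)) atTop
        (𝓝 (∫ u in Set.Ioi (0 : ℝ), Real.exp (β * u - u ^ 2 / 2))) := by
    refine tendsto_integral_filter_of_dominated_convergence
      (fun u => Real.exp (β * u₀ - u₀ ^ 2 / 2 - (β - u₀) * u₀ + 1) * Real.exp (-u)) ?_ ?_ ?_ ?_
    · exact Eventually.of_forall fun k => by
        apply Measurable.aestronglyMeasurable
        fun_prop
    · filter_upwards [hgood, hslope.eventually_lt_const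
        (show β - u₀ < -1 by rw [hu₀_def]; linarith [le_abs_self β]),
        hconst.eventually_lt_const (lt_add_one _)] with k ⟨h1, h2, h3⟩ h4 h5
      refine (ae_restrict_iff' measurableSet_Ioi).mpr (Eventually.of_forall fun u hu => ?_)
      have hu' : 0 < u := hu
      rw [Real.norm_eq_abs, Real.abs_exp, ← Real.exp_add]
      refine Real.exp_le_exp.mpr ?_
      have h6 := sq_mul_log_one_add_div_sub_le (r := r k) h2 hu'.le hu₀
      nlinarith [mul_lt_mul_of_pos_right h4 hu']
    · exact (integrableOn_exp_neg_Ioi 0).const_mul _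
    · refine (ae_restrict_iff' measurableSet_Ioi).mpr (Eventually.of_forall fun u hu => ?_)
      exact (Real.continuous_exp.tendsto _).comp
        (tendsto_sq_mul_log_one_add_div_sub hr hβ (le_of_lt hu))
  have hφ : 0 < stdGaussianPDF β := by unfold stdGaussianPDF; positivity
  rw [integral_exp_linear_sub_sq_eq] at hmain
  have hinv := (hmain.congr' hrepr).inv₀ (div_pos (stdGaussianCDF_pos β) hφ).ne'
  simpa only [inv_inv, inv_div] using hinv

theorem psi_mem_Icc {C : ℕ} (n : Fin C → ℕ) (α d : Fin C → ℝ) (f : ℕ → ℕ) (k : ℕ) :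
    psi n α d f k ∈ Set.Icc (0 : ℝ) 1 :=
  ⟨Real.sSup_nonneg fun _ hx => hx.1.1, Real.sSup_le (fun _ hx => hx.1.2) zero_le_one⟩

theorem one_sub_le_psi {C : ℕ} (n : Fin C → ℕ) (hn : ∀ i, 0 < n i) (α d : Fin C → ℝ)
    (htot : 0 < totDemand n α d) (f : ℕ → ℕ) (k : ℕ) (hk : 0 < k) (hf : 0 < f k)
    (hM : ((Finset.univ.sup n : ℕ) : ℝ) ≤ (k : ℝ) / f k) :
    1 - ((Finset.univ.sup n : ℕ) : ℝ) / ((k : ℝ) / f k) ≤ psi n α d f k := by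
  set M : ℝ := ((Finset.univ.sup n : ℕ) : ℝ)
  have hk' : (0 : ℝ) < k := Nat.cast_pos.mpr hk
  have hf' : (0 : ℝ) < f k := Nat.cast_pos.mpr hf
  have hN : 0 < (k : ℝ) / f k := by positivity
  refine le_csSup ⟨1, fun x hx => hx.1.2⟩ ⟨⟨?_, ?_⟩, ?_⟩
  · rw [sub_nonneg, div_le_one hN]
    exact hM
  · rw [sub_le_self_iff]
    positivity
  · set x := 1 - M / ((k : ℝ) / f k) with hx
    have hxk : x * k = k - M * f k := by
      rw [hx]
      field_simp
    have hle : ∑ i, (⌊x * ((k : ℝ) * relDemand n α d i /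
        ((n i : ℝ) * (f k : ℝ) * totDemand n α d))⌋ : ℝ) * ((n i : ℝ) * (f k : ℝ)) ≤ x * k := by
      calc _ ≤ ∑ i, x * k * (relDemand n α d i / totDemand n α d) := by
            refine Finset.sum_le_sum fun i _ => ?_
            have hni : (0 : ℝ) < n i := Nat.cast_pos.mpr (hn i)
            refine (mul_le_mul_of_nonneg_right (Int.floor_le _) (by positivity)).trans_eq ?_
            field_simp
        _ = x * k := by
            rw [← Finset.mul_sum, ← Finset.sum_div]
            change x * k * (totDemand n α d / totDemand n α d) = _
            rw [div_self htot.ne', mul_one]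
    have hsup : ((Finset.univ.sup (fun i => n i * f k) : ℕ) : ℝ) ≤ M * f k := by
      have : Finset.univ.sup (fun i => n i * f k) ≤ Finset.univ.sup n * f k :=
        Finset.sup_le fun i hi => Nat.mul_le_mul_right _ (Finset.le_sup (f := n) hi)
      calc _ ≤ ((Finset.univ.sup n * f k : ℕ) : ℝ) := Nat.cast_le.mpr this
        _ = M * f k := Nat.cast_mul _ _
    rw [ge_iff_le]
    linarith

/-- In the critically loaded regime, √(s_i^(k)) · E_{s_i^(k)}(λ^(k) α_i d_i) → φ(θ_i)/Φ(θ_i). -/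
theorem erlang_class_limit
    (C : ℕ) (hC : 0 < C) (n : Fin C → ℕ) (hn : ∀ i, 0 < n i)
    (α d : Fin C → ℝ) (hα : ∀ i, 0 < α i) (hd : ∀ i, 0 < d i)
    (hsum : ∑ i, α i = 1)
    (f : ℕ → ℕ) (hf : ∀ k, 0 < f k)
    (hfk : Tendsto (fun k : ℕ => (f k : ℝ) / k) atTop (𝓝 0))
    (θ : ℝ) (hθ : 0 < θ) (lam : ℕ → ℝ) (hlam : ∀ k, 0 < lam k)
    (hcrit : Tendsto
      (fun k : ℕ => (1 - lam k * totDemand n α d * f k / k) * Real.sqrt ((k : ℝ) / f k))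
      atTop (𝓝 θ))
    (i : Fin C) :
    Tendsto
      (fun k : ℕ =>
        Real.sqrt (srv n α d f i k) * erlangB (srv n α d f i k) (lam k * α i * d i))
      atTop (𝓝 (stdGaussianPDF (thetaI n α d θ i) / stdGaussianCDF (thetaI n α d θ i))) := by
  have hni : (0 : ℝ) < n i := Nat.cast_pos.mpr (hn i)
  have hrel : ∀ j, 0 < relDemand n α d j := fun j =>
    mul_pos (mul_pos (hα j) (hd j)) (Nat.cast_pos.mpr (hn j))
  have htot : 0 < totDemand n α d :=
    Finset.sum_pos (fun j _ => hrel j) ⟨i, Finset.mem_univ i⟩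
  set c : ℝ := relDemand n α d i / ((n i : ℝ) * totDemand n α d) with hc_def
  have hc : 0 < c := div_pos (hrel i) (mul_pos hni htot)
  set M : ℝ := ((Finset.univ.sup n : ℕ) : ℝ) with hM_def
  set N : ℕ → ℝ := fun k => (k : ℝ) / f k with hN_def
  set s := srv n α d f i with hs_def
  have hN : Tendsto N atTop atTop := by
    have hpos : ∀ᶠ k : ℕ in atTop, (f k : ℝ) / k ∈ Set.Ioi (0 : ℝ) := by
      filter_upwards [eventually_gt_atTop 0] with k hk
      have hfpos : (0 : ℝ) < f k := Nat.cast_pos.mpr (hf k)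
      have hkpos : (0 : ℝ) < k := Nat.cast_pos.mpr hk
      exact div_pos hfpos hkpos
    exact (tendsto_inv_nhdsGT_zero.comp
      (tendsto_nhdsWithin_of_tendsto_nhds_of_eventually_within _ hfk hpos)).congr
        fun k => inv_div _ _
  have hsrv : ∀ k, s k = ⌊psi n α d f k * (N k * c)⌋₊ := by
    intro k
    rw [hs_def, srv, hN_def, hc_def]
    congr 2
    have : (0 : ℝ) < f k := Nat.cast_pos.mpr (hf k)
    field_simp
  have hdiff : ∀ᶠ k in atTop, |(s k : ℝ) - N k * c| ≤ M * c + 1 := by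
    filter_upwards [hN.eventually_ge_atTop M, hN.eventually_gt_atTop 0,
      eventually_gt_atTop 0] with k h1 h2 h3
    obtain ⟨hψ0, hψ1⟩ := psi_mem_Icc n α d f k
    have hψ := one_sub_le_psi n hn α d htot f k h3 (hf k) h1
    have hNc : 0 < N k * c := mul_pos h2 hc
    have hup : (s k : ℝ) ≤ psi n α d f k * (N k * c) := by
      rw [hsrv]
      exact Nat.floor_le (mul_nonneg hψ0 hNc.le)
    have hlow : psi n α d f k * (N k * c) < s k + 1 := by
      rw [hsrv]
      exact Nat.lt_floor_add_one _
    have h4 : psi n α d f k * (N k * c) ≤ N k * c := mul_le_of_le_one_left hNc.le hψ1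
    have h5 : N k * c - M * c ≤ psi n α d f k * (N k * c) := by
      refine le_trans (le_of_eq ?_) (mul_le_mul_of_nonneg_right hψ hNc.le)
      change _ = (1 - M / N k) * (N k * c)
      field_simp
    have h6 : 0 ≤ M * c := mul_nonneg (Nat.cast_nonneg _) hc.le
    rw [abs_le]
    constructor <;> linarith
  have hsqrtN : Tendsto (fun k => Real.sqrt (N k)) atTop atTop :=
    Real.tendsto_sqrt_atTop.comp hN
  have hvanish : ∀ {g : ℕ → ℝ}, Tendsto g atTop atTop →
      Tendsto (fun k => ((s k : ℝ) - N k * c) / g k) atTop (𝓝 0) := by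
    intro g hg
    refine squeeze_zero_norm' ?_ (hg.const_div_atTop (M * c + 1))
    filter_upwards [hdiff, hg.eventually_gt_atTop 0] with k h1 h2
    rw [norm_div, Real.norm_eq_abs, Real.norm_eq_abs, abs_of_pos h2]
    gcongr
  have hsN : Tendsto (fun k => (s k : ℝ) / N k) atTop (𝓝 c) := by
    have h := (hvanish hN).add_const c
    rw [zero_add] at h
    refine h.congr' ?_
    filter_upwards [hN.eventually_gt_atTop 0] with k hk
    field_simp
    ring
  have hs : Tendsto s atTop atTop := by
    rw [← tendsto_natCast_atTop_iff (R := ℝ)]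
    refine (hsN.pos_mul_atTop hc hN).congr' ?_
    filter_upwards [hN.eventually_gt_atTop 0] with k hk
    field_simp
  refine tendsto_sqrt_mul_erlangB hs ?_
  have hnum := (hvanish hsqrtN).add (hcrit.const_mul c)
  have hquot := hnum.div hsN.sqrt (Real.sqrt_pos.mpr hc).ne'
  have hlim : (0 + c * θ) / Real.sqrt c = thetaI n α d θ i := by
    rw [thetaI, ← hc_def, zero_add, mul_div_right_comm, Real.div_sqrt, mul_comm]
  rw [hlim] at hquot
  refine hquot.congr' ?_
  filter_upwards [hN.eventually_gt_atTop 0, eventually_gt_atTop 0] with k hk hk0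
  have hkpos : (0 : ℝ) < k := Nat.cast_pos.mpr hk0
  have hfpos : (0 : ℝ) < f k := Nat.cast_pos.mpr (hf k)
  have hload : lam k * α i * d i = lam k * totDemand n α d * f k / k * (N k * c) := by
    rw [hN_def, hc_def, relDemand]
    field_simp
  have hsq : Real.sqrt (N k) ^ 2 = N k := Real.sq_sqrt hk.le
  have hsqpos : 0 < Real.sqrt (N k) := Real.sqrt_pos.mpr hk
  rw [hload]
  change (((s k : ℝ) - N k * c) / √(N k) +
    c * ((1 - lam k * totDemand n α d * f k / k) * √(N k))) / √(s k / N k) = _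
  rw [Real.sqrt_div (Nat.cast_nonneg (s k)), div_div_eq_mul_div]
  congr 1
  rw [add_mul, div_mul_cancel₀ _ hsqpos.ne']
  linear_combination c * (1 - lam k * totDemand n α d * f k / k) * hsq
end
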